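/- Let K be a field, M a finitely generated Lie algebra over K, i ≥ 1 a natural number, and 0 → R → L → M → 0 any i-central extension of Lie algebras over K. Then γ_{i+1}(L) is finitely generated as a Lie algebra if and only if γ_{i+1}(M) is finitely generated as a Lie algebra. -/

import Mathlib

/-- A Lie algebra `A` over `K` is finitely generated (as a Lie algebra):
there is a finite subset generating `A` as a Lie algebra. -/
def LieAlgebraFG (K A : Type*) [Field K] [LieRing A] [LieAlgebra K A] : Prop :=
  ∃ S : Finset A, LieSubalgebra.lieSpan K A ↑S = ⊤

/-- A Lie algebra `A` over `K` is finitely presented: it is isomorphic to the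
quotient of the free Lie algebra on a finite set by an ideal generated (as an
ideal) by finitely many elements. -/
def LieAlgebraFP (K A : Type*) [Field K] [LieRing A] [LieAlgebra K A] : Prop :=
  ∃ (n : ℕ) (S : Finset (FreeLieAlgebra K (Fin n))),
    Nonempty ((FreeLieAlgebra K (Fin n) ⧸
      (LieSubmodule.lieSpan K (FreeLieAlgebra K (Fin n))
        (↑S : Set (FreeLieAlgebra K (Fin n))) :
          LieIdeal K (FreeLieAlgebra K (Fin n)))) ≃ₗ⁅K⁆ A)

/-- `gammaRel K L R j = γ_{j+1}(R, L)` : `γ_1(R, L) = R` and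
`γ_{j+1}(R, L) = ⁅γ_j(R, L), L⁆`. -/
def gammaRel (K L : Type*) [Field K] [LieRing L] [LieAlgebra K L]
    (R : LieIdeal K L) : ℕ → LieIdeal K L
  | 0 => R
  | j + 1 => ⁅gammaRel K L R j, (⊤ : LieIdeal K L)⁆

/-- `gammaLCS K M i = γ_{i+1}(M)` : the lower central series `γ_1(M) = M`,
`γ_{i+1}(M) = ⁅γ_i(M), M⁆`. -/
def gammaLCS (K M : Type*) [Field K] [LieRing M] [LieAlgebra K M] (i : ℕ) : LieIdeal K M :=
  gammaRel K M ⊤ i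

universe u v

section RelativeLowerCentralSeries

variable {K L : Type*} [Field K] [LieRing L] [LieAlgebra K L]

theorem gammaLCS_succ (i : ℕ) :
    gammaLCS K L (i + 1) = ⁅gammaLCS K L i, (⊤ : LieIdeal K L)⁆ := rfl

theorem lie_mem_gammaRel_succ {R : LieIdeal K L} {j : ℕ} (x : L) {y : L}
    (hy : y ∈ gammaRel K L R j) : ⁅x, y⁆ ∈ gammaRel K L R (j + 1) := by
  rw [gammaRel, LieSubmodule.lie_comm]
  exact LieSubmodule.lie_mem_lie (LieSubmodule.mem_top x) hy

theorem gammaLCS_lie_gammaRel_le (R : LieIdeal K L) (k n : ℕ) :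
    ⁅gammaLCS K L k, gammaRel K L R n⁆ ≤ gammaRel K L R (n + k + 1) := by
  induction k generalizing n with
  | zero =>
    rw [LieSubmodule.lie_le_iff]
    exact fun x _ m hm => lie_mem_gammaRel_succ x hm
  | succ k ih =>
    rw [gammaLCS_succ, LieSubmodule.lie_le_iff]
    intro w hw z hz
    rw [← LieSubmodule.mem_toSubmodule, LieSubmodule.lieIdeal_oper_eq_linear_span'] at hw
    induction hw using Submodule.span_induction with
    | mem w hw =>
      obtain ⟨a, ha, y, -, rfl⟩ := hw
      rw [lie_lie]
      refine sub_mem ?_ (lie_mem_gammaRel_succ y (ih n (LieSubmodule.lie_mem_lie ha hz)))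
      have := ih (n + 1) (LieSubmodule.lie_mem_lie ha (lie_mem_gammaRel_succ y hz))
      rwa [Nat.add_right_comm n 1 k] at this
    | zero => simp
    | add a b _ _ ha hb => rw [add_lie]; exact add_mem ha hb
    | smul c a _ ha => rw [smul_lie]; exact SMulMemClass.smul_mem c ha

theorem map_gammaLCS {M : Type*} [LieRing M] [LieAlgebra K M] {π : L →ₗ⁅K⁆ M}
    (hπ : Function.Surjective π) (i : ℕ) :
    LieIdeal.map π (gammaLCS K L i) = gammaLCS K M i := by
  have htop : LieIdeal.map π (⊤ : LieIdeal K L) = ⊤ := by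
    rw [eq_top_iff]
    intro y _
    obtain ⟨x, rfl⟩ := hπ y
    exact LieIdeal.mem_map (LieSubmodule.mem_top x)
  induction i with
  | zero => exact htop
  | succ i ih => rw [gammaLCS_succ, gammaLCS_succ, LieIdeal.map_bracket_eq π hπ, ih, htop]

theorem mem_gammaLCS_iff_of_surjective {M : Type*} [LieRing M] [LieAlgebra K M] {π : L →ₗ⁅K⁆ M}
    (hπ : Function.Surjective π) (i : ℕ) (y : M) :
    y ∈ gammaLCS K M i ↔ ∃ x ∈ gammaLCS K L i, π x = y := by
  rw [← map_gammaLCS hπ]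
  constructor
  · intro h
    obtain ⟨x, hx⟩ := LieIdeal.mem_map_of_surjective hπ h
    exact ⟨x, x.2, hx⟩
  · rintro ⟨x, hx, rfl⟩
    exact LieIdeal.mem_map hx

end RelativeLowerCentralSeries

section FiniteGeneration

variable {K L : Type*} [Field K] [LieRing L] [LieAlgebra K L]

theorem lieAlgebraFG_lieSubalgebra_iff (A : LieSubalgebra K L) :
    LieAlgebraFG K A ↔ ∃ S : Set L, S.Finite ∧ LieSubalgebra.lieSpan K L S = A := by
  have hrange : LieSubalgebra.map A.incl ⊤ = A := by
    ext x
    simp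
  have hinj : Function.Injective (LieSubalgebra.map A.incl) := by
    intro B C h
    apply SetLike.coe_injective
    apply Subtype.val_injective.image_injective
    exact congrArg SetLike.coe h
  constructor
  · rintro ⟨S, hS⟩
    refine ⟨A.incl '' S, S.finite_toSet.image _, ?_⟩
    rw [← LieSubalgebra.map_lieSpan, hS, hrange]
  · rintro ⟨S, hfin, hS⟩
    have hsub : S ⊆ Set.range A.incl := by
      intro x hx
      have hxA : x ∈ A := hS ▸ LieSubalgebra.subset_lieSpan hx
      exact ⟨⟨x, hxA⟩, rfl⟩
    have hfin' : (A.incl ⁻¹' S).Finite := hfin.preimage Subtype.val_injective.injOn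
    refine ⟨hfin'.toFinset, hinj ?_⟩
    rw [Set.Finite.coe_toFinset, LieSubalgebra.map_lieSpan,
      Set.image_preimage_eq_of_subset hsub, hS, hrange]

theorem lieAlgebraFG_lieIdeal_iff (I : LieIdeal K L) :
    LieAlgebraFG K I ↔
      ∃ S : Set L, S.Finite ∧ LieSubalgebra.lieSpan K L S = I.toLieSubalgebra :=
  lieAlgebraFG_lieSubalgebra_iff I.toLieSubalgebra

theorem LieAlgebraFG.gammaLCS_of_surjective {M : Type*} [LieRing M] [LieAlgebra K M]
    {π : L →ₗ⁅K⁆ M} (hπ : Function.Surjective π) {i : ℕ} (h : LieAlgebraFG K (gammaLCS K L i)) :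
    LieAlgebraFG K (gammaLCS K M i) := by
  rw [lieAlgebraFG_lieIdeal_iff] at h ⊢
  obtain ⟨S, hfin, hS⟩ := h
  refine ⟨π '' S, hfin.image π, ?_⟩
  rw [← LieSubalgebra.map_lieSpan, hS]
  ext y
  simp [mem_gammaLCS_iff_of_surjective hπ]

/-- If `L` is generated by `X` modulo the ideal `R`, then the terms of its lower central series are
generated, as ideals and modulo the relative lower central series of `R`, by finitely many
elements. -/
theorem exists_finite_gammaLCS_le {R : LieIdeal K L} {X : Set L} (hX : X.Finite)
    (hgen : LieSubalgebra.lieSpan K L (X ∪ R) = ⊤) (k : ℕ) :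
    ∃ C : Set L, C.Finite ∧ C ⊆ gammaLCS K L k ∧
      gammaLCS K L k ≤ LieSubmodule.lieSpan K L C ⊔ gammaRel K L R k := by
  induction k with
  | zero =>
    refine ⟨X, hX, fun x _ => LieSubmodule.mem_top x, fun z _ => ?_⟩
    have hz : z ∈ LieSubalgebra.lieSpan K L (X ∪ R) := hgen ▸ LieSubalgebra.mem_top z
    refine (LieSubalgebra.lieSpan_le (K := LieIdeal.toLieSubalgebra K L
      (LieSubmodule.lieSpan K L X ⊔ gammaRel K L R 0))).mpr ?_ hz
    rintro x (hx | hx)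
    · exact LieSubmodule.mem_sup_left (N' := R) (LieSubmodule.subset_lieSpan hx)
    · exact LieSubmodule.mem_sup_right (N' := R) hx
  | succ k ih =>
    obtain ⟨C, hC, hCk, hle⟩ := ih
    refine ⟨Set.image2 (fun x c => ⁅x, c⁆) X C, hX.image2 _ hC, ?_, ?_⟩
    · rintro _ ⟨x, _, c, hc, rfl⟩
      exact lie_mem_gammaRel_succ x (hCk hc)
    set J := LieSubmodule.lieSpan K L (Set.image2 (fun x c => ⁅x, c⁆) X C) ⊔
      gammaRel K L R (k + 1)
    have hCJ : ∀ c ∈ C, ∀ z : L, ⁅z, c⁆ ∈ J := by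
      intro c hc z
      have hz : z ∈ LieSubalgebra.lieSpan K L (X ∪ R) := hgen ▸ LieSubalgebra.mem_top z
      induction hz using LieSubalgebra.lieSpan_induction with
      | mem x hx =>
        rcases hx with hx | hx
        · exact LieSubmodule.mem_sup_left (LieSubmodule.subset_lieSpan ⟨x, hx, c, hc, rfl⟩)
        · refine LieSubmodule.mem_sup_right ?_
          rw [← lie_skew, neg_mem_iff]
          have := gammaLCS_lie_gammaRel_le R k 0 (LieSubmodule.lie_mem_lie (hCk hc) hx)
          rwa [Nat.zero_add] at this
      | zero => simp
      | add x y _ _ hx hy => rw [add_lie]; exact add_mem hx hy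
      | smul a x _ hx => rw [smul_lie]; exact J.smul_mem a hx
      | lie x y _ _ hx hy => rw [lie_lie]; exact sub_mem (J.lie_mem hy) (J.lie_mem hx)
    rw [gammaLCS_succ, LieSubmodule.lie_comm]
    refine (LieSubmodule.mono_lie_right _ hle).trans ?_
    rw [LieSubmodule.lie_sup]
    refine sup_le ?_ ?_
    · rw [LieSubmodule.lie_le_iff]
      intro z _ w hw
      induction hw using LieSubmodule.lieSpan_induction generalizing z with
      | mem c hc => exact hCJ c hc z
      | zero => simp
      | add x y _ _ hx hy =>
        rw [lie_add]
        exact add_mem (hx z (LieSubmodule.mem_top z)) (hy z (LieSubmodule.mem_top z))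
      | smul a x _ hx => rw [lie_smul]; exact J.smul_mem a (hx z (LieSubmodule.mem_top z))
      | lie y x _ hx =>
        rw [leibniz_lie]
        exact add_mem (hx _ (LieSubmodule.mem_top _)) (J.lie_mem (hx z (LieSubmodule.mem_top z)))
    · rw [LieSubmodule.lie_comm]
      exact le_sup_right

/-- If `R` is `i`-central, a finite subset of `R ⊓ N` is contained in a finite subset which is
stable under bracketing with the elements of a given finite set. -/
theorem exists_finite_lie_stable {R N : LieIdeal K L} {i : ℕ} (hR : gammaRel K L R i = ⊥)
    {X : Set L} (hX : X.Finite) (j m : ℕ) (hjm : m + j = i) (T : Set L) (hT : T.Finite)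
    (hTR : T ⊆ gammaRel K L R m) (hTN : T ⊆ N) :
    ∃ T' : Set L, T'.Finite ∧ T ⊆ T' ∧ T' ⊆ N ∧ ∀ x ∈ X, ∀ t ∈ T', ⁅x, t⁆ ∈ T' := by
  induction j generalizing m T with
  | zero =>
    obtain rfl : m = i := hjm
    refine ⟨T, hT, subset_rfl, hTN, fun x _ t ht => ?_⟩
    have h0 : t = 0 := by simpa [hR] using hTR ht
    subst h0
    simpa using ht
  | succ j ih =>
    obtain ⟨T', hfin, hsub, hN, hst⟩ := ih (m + 1) (by omega)
      (Set.image2 (fun x t => ⁅x, t⁆) X T) (hX.image2 _ hT)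
      (by rintro _ ⟨x, _, t, ht, rfl⟩; exact lie_mem_gammaRel_succ x (hTR ht))
      (by rintro _ ⟨x, _, t, ht, rfl⟩; exact N.lie_mem (hTN ht))
    refine ⟨T ∪ T', hT.union hfin, Set.subset_union_left, Set.union_subset hTN hN, ?_⟩
    rintro x hx t (ht | ht)
    · exact Or.inr (hsub ⟨x, hx, t, ht, rfl⟩)
    · exact Or.inr (hst x hx t ht)

theorem LieAlgebraFG.gammaLCS_of_gammaRel_ker_eq_bot {M : Type*} [LieRing M] [LieAlgebra K M]
    (hM : LieAlgebraFG K M) {π : L →ₗ⁅K⁆ M} (hπ : Function.Surjective π) {i : ℕ}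
    (hcent : gammaRel K L π.ker i = ⊥) (h : LieAlgebraFG K (gammaLCS K M i)) :
    LieAlgebraFG K (gammaLCS K L i) := by
  rw [lieAlgebraFG_lieIdeal_iff] at h ⊢
  obtain ⟨XM, hXM⟩ := hM
  obtain ⟨SM, hSMfin, hSM⟩ := h
  have hlift : ∀ {Y : Set L} {z : L}, π z ∈ LieSubalgebra.lieSpan K M (π '' Y) →
      ∃ y ∈ LieSubalgebra.lieSpan K L Y, z - y ∈ π.ker := by
    intro Y z hz
    rw [← LieSubalgebra.map_lieSpan] at hz
    obtain ⟨y, hy, hyz⟩ := hz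
    refine ⟨y, hy, ?_⟩
    rw [LieHom.mem_ker, map_sub, sub_eq_zero]
    exact hyz.symm
  obtain ⟨X, -, hXfin, hXim⟩ : ∃ X ⊆ (Set.univ : Set L), X.Finite ∧ π '' X = XM := by
    obtain ⟨X, hX, hbij⟩ := Set.SurjOn.exists_bijOn_subset
      (f := π) (s := Set.univ) (t := (XM : Set M)) (fun y _ => by simpa using hπ y)
    exact ⟨X, hX, Set.Finite.of_finite_image (hbij.image_eq ▸ XM.finite_toSet) hbij.injOn,
      hbij.image_eq⟩
  obtain ⟨S, hSN, hSfin, hSim⟩ : ∃ S ⊆ (gammaLCS K L i : Set L), S.Finite ∧ π '' S = SM := by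
    obtain ⟨S, hS, hbij⟩ := Set.SurjOn.exists_bijOn_subset
      (f := π) (s := (gammaLCS K L i : Set L)) (t := SM) (fun y hy => by
        have : y ∈ LieSubalgebra.lieSpan K M SM := LieSubalgebra.subset_lieSpan hy
        rw [hSM] at this
        exact (mem_gammaLCS_iff_of_surjective hπ i y).mp this)
    exact ⟨S, hS, Set.Finite.of_finite_image (hbij.image_eq ▸ hSMfin) hbij.injOn, hbij.image_eq⟩
  have hgen : LieSubalgebra.lieSpan K L (X ∪ π.ker) = ⊤ := by
    rw [eq_top_iff]
    intro z _
    obtain ⟨y, hy, hzy⟩ := hlift (Y := X) (z := z) (by rw [hXim, hXM]; exact LieSubalgebra.mem_top _)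
    rw [← add_sub_cancel y z]
    exact add_mem (LieSubalgebra.lieSpan_mono Set.subset_union_left hy)
      (LieSubalgebra.subset_lieSpan (Or.inr hzy))
  obtain ⟨C, hCfin, hCN, hC⟩ := exists_finite_gammaLCS_le hXfin hgen i
  rw [hcent, sup_bot_eq] at hC
  have hred : ∀ n ∈ gammaLCS K L i, ∃ y ∈ LieSubalgebra.lieSpan K L S, n - y ∈ π.ker := by
    intro n hn
    apply hlift
    rw [hSim, hSM]
    exact (mem_gammaLCS_iff_of_surjective hπ i _).mpr ⟨n, hn, rfl⟩
  choose! y hyS hyR using hred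
  have hSN' : LieSubalgebra.lieSpan K L S ≤ (gammaLCS K L i).toLieSubalgebra :=
    LieSubalgebra.lieSpan_le.mpr hSN
  have hSCN : S ∪ C ⊆ gammaLCS K L i := Set.union_subset hSN hCN
  obtain ⟨T, hTfin, hsubT, hTN, hTst⟩ := exists_finite_lie_stable (N := gammaLCS K L i) hcent hXfin
    i 0 (Nat.zero_add i) (Set.image2 (fun x s => ⁅x, s⁆ - y ⁅x, s⁆) X (S ∪ C))
    (hXfin.image2 _ (hSfin.union hCfin))
    (by
      rintro _ ⟨x, _, s, hs, rfl⟩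
      exact hyR _ (LieSubmodule.lie_mem _ (hSCN hs)))
    (by
      rintro _ ⟨x, _, s, hs, rfl⟩
      have hxs : ⁅x, s⁆ ∈ gammaLCS K L i := LieSubmodule.lie_mem _ (hSCN hs)
      exact sub_mem hxs (hSN' (hyS _ hxs)))
  set Q := LieSubalgebra.lieSpan K L (S ∪ C ∪ T)
  have hQN : Q ≤ (gammaLCS K L i).toLieSubalgebra :=
    LieSubalgebra.lieSpan_le.mpr (Set.union_subset hSCN hTN)
  have hSQ : LieSubalgebra.lieSpan K L S ≤ Q :=
    LieSubalgebra.lieSpan_mono (fun s hs => Or.inl (Or.inl hs))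
  have hTQ : T ⊆ Q := fun t ht => LieSubalgebra.subset_lieSpan (Or.inr ht)
  have hXQ : ∀ x ∈ X, ∀ q ∈ Q, ⁅x, q⁆ ∈ Q := by
    intro x hx q hq
    induction hq using LieSubalgebra.lieSpan_induction with
    | mem s hs =>
      rcases hs with hs | hs
      · rw [← add_sub_cancel (y ⁅x, s⁆) ⁅x, s⁆]
        exact add_mem (hSQ (hyS _ (LieSubmodule.lie_mem _ (hSCN hs))))
          (hTQ (hsubT ⟨x, hx, s, hs, rfl⟩))
      · exact hTQ (hTst x hx s hs)
    | zero => simp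
    | add a b _ _ ha hb => rw [lie_add]; exact add_mem ha hb
    | smul a b _ hb => rw [lie_smul]; exact Q.smul_mem a hb
    | lie a b ha' hb' ha hb =>
      rw [leibniz_lie]
      exact add_mem (Q.lie_mem ha hb') (Q.lie_mem ha' hb)
  have hideal : ∀ z : L, ∀ q ∈ Q, ⁅z, q⁆ ∈ Q := by
    intro z
    have hz : z ∈ LieSubalgebra.lieSpan K L (X ∪ π.ker) := hgen ▸ LieSubalgebra.mem_top z
    induction hz using LieSubalgebra.lieSpan_induction with
    | mem x hx =>
      rcases hx with hx | hx
      · exact hXQ x hx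
      · intro q hq
        have h1 := gammaLCS_lie_gammaRel_le π.ker i 0 (LieSubmodule.lie_mem_lie (hQN hq) hx)
        rw [Nat.zero_add, gammaRel, hcent, LieSubmodule.bot_lie, LieSubmodule.mem_bot] at h1
        rw [← lie_skew, h1, neg_zero]
        exact zero_mem Q
    | zero => simp
    | add a b _ _ ha hb =>
      intro q hq
      rw [add_lie]
      exact add_mem (ha q hq) (hb q hq)
    | smul a b _ hb =>
      intro q hq
      rw [smul_lie]
      exact Q.smul_mem a (hb q hq)
    | lie a b _ _ ha hb =>
      intro q hq
      rw [lie_lie]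
      exact sub_mem (ha _ (hb q hq)) (hb _ (ha q hq))
  refine ⟨S ∪ C ∪ T, (hSfin.union hCfin).union hTfin, le_antisymm hQN ?_⟩
  let I : LieIdeal K L := { Q.toSubmodule with lie_mem := fun {z q} hq => hideal z q hq }
  have hCI : LieSubmodule.lieSpan K L C ≤ I :=
    LieSubmodule.lieSpan_le.mpr fun c hc => LieSubalgebra.subset_lieSpan (Or.inl (Or.inr hc))
  exact fun n hn => hCI (hC hn)

end FiniteGeneration

theorem gamma_fg_iff_of_icentral_ext (K : Type*) [Field K]
    (M : Type u) [LieRing M] [LieAlgebra K M]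
    (hM : LieAlgebraFG K M) (i : ℕ) (hi : 1 ≤ i)
    (L : Type v) [LieRing L] [LieAlgebra K L] (π : L →ₗ⁅K⁆ M)
    (hsurj : Function.Surjective π) (hcent : gammaRel K L π.ker i = ⊥) :
    LieAlgebraFG K ↑(gammaLCS K L i) ↔ LieAlgebraFG K ↑(gammaLCS K M i) :=
  ⟨fun h => h.gammaLCS_of_surjective hsurj,
    fun h => hM.gammaLCS_of_gammaRel_ker_eq_bot hsurj hcent h⟩
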